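/- Let q be odd and S₀ ⊆ 𝔽_qˣ finite, and let A = {α ∈ 𝔽_{q²}ˣ : (α^{q+1})⁻¹ ∈ S₀}. The group Γ_S is isomorphic to the group presented by generators a_α for α ∈ A, subject to the relations a_α·a_{−α} = 1 for all α ∈ A, and a_α·a_β = a_{ζ_α(β)·β}·a_{ζ_β(α)·α} for all α, β ∈ A with α^{q+1} ≠ β^{q+1}, via the map sending a_α to the class [1 + α·j]. -/

import Mathlib

open Polynomial Quaternion

noncomputable section

/-- The multiplicative set of `𝔽_q[t]` generated by `t` and `t - τ` for `τ ∈ S₀`. -/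
def sden (F : Type) [Field F] (S₀ : Set F) : Submonoid F[X] :=
  Submonoid.closure ({X} ∪ (fun τ : F => X - C τ) '' S₀)

/-- The ring `o_S`, the localization of `𝔽_q[t]` inverting `t` and `t - τ` for `τ ∈ S₀`. -/
abbrev OS (F : Type) [Field F] (S₀ : Set F) := Localization (sden F S₀)

/-- The quaternion algebra `ℍ[o_S, c, t]` with `i² = c`, `j² = t`, `ij = -ji = k`. -/
abbrev QAS (F : Type) [Field F] (S₀ : Set F) (c : F) : Type :=
  ℍ[OS F S₀, algebraMap F[X] (OS F S₀) (C c), algebraMap F[X] (OS F S₀) X]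

/-- The central subgroup of scalar units. -/
def scalarUnits (R A : Type*) [CommRing R] [Ring A] [Algebra R A] : Subgroup Aˣ :=
  (Units.map (algebraMap R A).toMonoidHom).range

instance scalarUnits_normal (R A : Type*) [CommRing R] [Ring A] [Algebra R A] :
    (scalarUnits R A).Normal := by
  constructor
  intro n hn g
  obtain ⟨r, rfl⟩ := hn
  refine ⟨r, ?_⟩
  ext
  simp only [Units.val_mul, Units.coe_map, RingHom.toMonoidHom_eq_coe, MonoidHom.coe_coe]
  rw [← Algebra.commutes (r : R) ((g : Aˣ) : A), mul_assoc, Units.mul_inv, mul_one]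

/-- The group `Λ_S = ℍ[o_S, c, t]ˣ/o_Sˣ`. -/
abbrev LambdaS (F : Type) [Field F] (S₀ : Set F) (c : F) : Type :=
  (QAS F S₀ c)ˣ ⧸ scalarUnits (OS F S₀) (QAS F S₀ c)

/-- The class `[w]` of a unit `w`. -/
abbrev clsS (F : Type) [Field F] (S₀ : Set F) (c : F) : (QAS F S₀ c)ˣ →* LambdaS F S₀ c :=
  QuotientGroup.mk' _

/-- The canonical map `F → o_S`. -/
def toOS (F : Type) [Field F] (S₀ : Set F) : F →+* OS F S₀ :=
  (algebraMap F[X] (OS F S₀)).comp (C : F →+* F[X])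

/-- The quaternion `1 + α·j = 1 + x·j + y·k` for `α = x + y·√c ∈ 𝔽_{q²}`. -/
def oneAddJ (F : Type) [Field F] (S₀ : Set F) (c : F) (x y : F) : QAS F S₀ c :=
  ⟨1, 0, toOS F S₀ x, toOS F S₀ y⟩

/-- `α = x + y·√c` in `𝔽_{q²} = F(√c)`. -/
def hasCoord (F : Type) [Field F] (E : Type) [Field E] [Algebra F E] (s : E)
    (α : E) (x y : F) : Prop :=
  α = algebraMap F E x + algebraMap F E y * s

/-- The set `PA_τ = {[1 + α·j] : α ∈ 𝔽_{q²}, N(α) = α^{q+1} = τ⁻¹} ⊆ Λ_S`. -/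
def PASet (F : Type) [Field F] [Fintype F] (E : Type) [Field E] [Algebra F E] (s : E)
    (S₀ : Set F) (c : F) (τ : F) : Set (LambdaS F S₀ c) :=
  {z | ∃ (α : E) (x y : F) (w : (QAS F S₀ c)ˣ),
    hasCoord F E s α x y ∧
    α ^ (Fintype.card F + 1) = algebraMap F E τ⁻¹ ∧
    (w : QAS F S₀ c) = oneAddJ F S₀ c x y ∧
    z = clsS F S₀ c w}

/-- The group `Γ_S`, generated by all `PA_τ`, `τ ∈ S₀`. -/
def GammaS (F : Type) [Field F] [Fintype F] (E : Type) [Field E] [Algebra F E] (s : E)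
    (S₀ : Set F) (c : F) : Subgroup (LambdaS F S₀ c) :=
  Subgroup.closure (⋃ τ ∈ S₀, PASet F E s S₀ c τ)


/-- `ζ_α(β) = (1 + α/β)/(1 + ᾱ/β̄)`, where `ᾱ = α^q`. -/
def zeta (F : Type) [Field F] [Fintype F] (E : Type) [Field E] (α β : E) : E :=
  (1 + α / β) / (1 + α ^ Fintype.card F / β ^ Fintype.card F)

/-- The generating set `A = {α ∈ 𝔽_{q²}ˣ : (α^{q+1})⁻¹ ∈ S₀}`. -/
def genSet (F : Type) [Field F] [Fintype F] (E : Type) [Field E] [Algebra F E]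
    (S₀ : Set F) : Set E :=
  {α : E | α ≠ 0 ∧ ∃ τ ∈ S₀, α ^ (Fintype.card F + 1) = algebraMap F E τ⁻¹}

/-- The relations of the presentation of `Γ_S`: `a_α·a_{-α} = 1` and
`a_α·a_β = a_{ζ_α(β)·β}·a_{ζ_β(α)·α}` whenever `α^{q+1} ≠ β^{q+1}`. -/
def gammaRels (F : Type) [Field F] [Fintype F] (E : Type) [Field E] [Algebra F E]
    (S₀ : Set F) : Set (FreeGroup (genSet F E S₀)) :=
  {r | ∃ α α' : genSet F E S₀, (α' : E) = -(α : E) ∧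
        r = FreeGroup.of α * FreeGroup.of α'} ∪
  {r | ∃ α β γ γ' : genSet F E S₀,
        (α : E) ^ (Fintype.card F + 1) ≠ (β : E) ^ (Fintype.card F + 1) ∧
        (γ : E) = zeta F E (α : E) (β : E) * (β : E) ∧
        (γ' : E) = zeta F E (β : E) (α : E) * (α : E) ∧
        r = FreeGroup.of α * FreeGroup.of β * (FreeGroup.of γ * FreeGroup.of γ')⁻¹}

/-- The map of quaternion algebras induced by a ring homomorphism. -/
def quaternionMap {R S : Type*} [CommRing R] [CommRing S] (f : R →+* S) (a b : R) :
    ℍ[R, a, b] →+* ℍ[S, f a, f b] where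
  toFun z := ⟨f z.re, f z.imI, f z.imJ, f z.imK⟩
  map_one' := by ext <;> simp
  map_zero' := by ext <;> simp
  map_add' z w := by ext <;> simp
  map_mul' z w := by ext <;> simp

section Coordinates

variable {F : Type} [Field F] {c : F} {E : Type} [Field E] [Algebra F E] {s : E}

theorem coord_unique (hc : ¬IsSquare c) (hs : s ^ 2 = algebraMap F E c) {x y x' y' : F}
    (h : algebraMap F E x + algebraMap F E y * s = algebraMap F E x' + algebraMap F E y' * s) :
    x = x' ∧ y = y' := by
  have hy : y = y' := by
    by_contra hne
    have hne' : algebraMap F E (y - y') ≠ 0 := by simpa [sub_eq_zero] using hne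
    refine hc ⟨(x' - x) / (y - y'), (algebraMap F E).injective ?_⟩
    have : s = algebraMap F E ((x' - x) / (y - y')) := by
      rw [map_div₀, eq_div_iff hne']
      simp only [map_sub]
      linear_combination h
    rw [← hs, this, map_mul, sq]
  subst hy
  exact ⟨(algebraMap F E).injective (add_right_cancel h), rfl⟩

theorem conj_coord [Fintype F] (hq : Odd (Fintype.card F)) (hc : ¬IsSquare c)
    (hs : s ^ 2 = algebraMap F E c) (x y : F) :
    (algebraMap F E x + algebraMap F E y * s) ^ Fintype.card F =
      algebraMap F E x - algebraMap F E y * s := by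
  have hchar : ringChar F ≠ 2 := fun h => by
    have := FiniteField.even_card_of_char_two h
    rw [Nat.odd_iff] at hq
    omega
  have hc0 : c ≠ 0 := by
    rintro rfl
    exact hc (IsSquare.zero)
  have hcpow : c ^ (Fintype.card F / 2) = -1 :=
    (FiniteField.pow_dichotomy hchar hc0).resolve_left
      (mt (FiniteField.isSquare_iff hchar hc0).2 hc)
  have hspow : s ^ Fintype.card F = -s := by
    conv_lhs => rw [← Nat.two_mul_div_two_add_one_of_odd hq]
    rw [pow_succ, pow_mul, hs, ← map_pow, hcpow]
    simp
  have h := map_add (FiniteField.frobeniusAlgHom F E) (algebraMap F E x) (algebraMap F E y * s)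
  rw [map_mul, AlgHom.commutes, AlgHom.commutes] at h
  simp only [FiniteField.frobeniusAlgHom_apply, hspow] at h
  rw [h]
  ring

theorem conj_add [Fintype F] (α β : E) : (α + β) ^ Fintype.card F =
    α ^ Fintype.card F + β ^ Fintype.card F :=
  map_add (FiniteField.frobeniusAlgHom F E) α β

theorem conj_conj [Fintype F] (hq : Odd (Fintype.card F)) (hc : ¬IsSquare c)
    (hs : s ^ 2 = algebraMap F E c) (hspan : ∀ α : E, ∃ x y : F, hasCoord F E s α x y) (α : E) :
    (α ^ Fintype.card F) ^ Fintype.card F = α := by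
  obtain ⟨x, y, rfl⟩ := hspan α
  rw [conj_coord hq hc hs]
  have := conj_coord hq hc hs x (-y)
  simp only [map_neg, neg_mul, sub_neg_eq_add, ← sub_eq_add_neg] at this
  exact this

end Coordinates

section Zeta

variable {F : Type} [Fintype F] {E : Type} [Field E]

theorem add_ne_zero_of_norm_ne (hq : Odd (Fintype.card F)) {α β : E}
    (h : α ^ (Fintype.card F + 1) ≠ β ^ (Fintype.card F + 1)) : α + β ≠ 0 := by
  intro h0
  rw [eq_neg_of_add_eq_zero_left h0, hq.add_one.neg_pow] at h
  exact h rfl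

variable [Field F] [Algebra F E]

theorem zeta_mul (hq : Odd (Fintype.card F)) {α β : E} (hβ : β ≠ 0)
    (h : α ^ (Fintype.card F + 1) ≠ β ^ (Fintype.card F + 1)) :
    zeta F E α β * β = (α + β) * β ^ Fintype.card F / (α + β) ^ Fintype.card F := by
  have h1 := pow_ne_zero (Fintype.card F) (add_ne_zero_of_norm_ne hq h)
  have h2 := h1
  rw [conj_add] at h1
  have h3 := pow_ne_zero (Fintype.card F) hβ
  have h4 : 1 + α ^ Fintype.card F / β ^ Fintype.card F ≠ 0 := by
    rw [one_add_div h3, add_comm]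
    exact div_ne_zero h1 h3
  rw [zeta, conj_add, div_mul_eq_mul_div, div_eq_div_iff h4 h1]
  field_simp
  ring

theorem zeta_mul_norm (hq : Odd (Fintype.card F))
    (hconj : ∀ α : E, (α ^ Fintype.card F) ^ Fintype.card F = α) {α β : E} (hβ : β ≠ 0)
    (h : α ^ (Fintype.card F + 1) ≠ β ^ (Fintype.card F + 1)) :
    (zeta F E α β * β) ^ (Fintype.card F + 1) = β ^ (Fintype.card F + 1) := by
  have h0 := add_ne_zero_of_norm_ne hq h
  have h1 := pow_ne_zero (Fintype.card F) h0
  rw [zeta_mul hq hβ h, pow_succ, div_pow, mul_pow, hconj, hconj, pow_succ]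
  field_simp

theorem zeta_mul_add (hq : Odd (Fintype.card F)) {α β : E} (hα : α ≠ 0) (hβ : β ≠ 0)
    (h : α ^ (Fintype.card F + 1) ≠ β ^ (Fintype.card F + 1)) :
    zeta F E α β * β + zeta F E β α * α = α + β := by
  have h1 := pow_ne_zero (Fintype.card F) (add_ne_zero_of_norm_ne hq h)
  rw [zeta_mul hq hβ h, zeta_mul hq hα h.symm, add_comm β α, ← add_div, ← mul_add,
    add_comm (β ^ _), ← conj_add, mul_div_cancel_right₀ _ h1]

theorem zeta_mul_conj (hq : Odd (Fintype.card F))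
    (hconj : ∀ α : E, (α ^ Fintype.card F) ^ Fintype.card F = α) {α β : E}
    (hα : α ≠ 0) (hβ : β ≠ 0)
    (h : α ^ (Fintype.card F + 1) ≠ β ^ (Fintype.card F + 1)) :
    zeta F E α β * β * (zeta F E β α * α) ^ Fintype.card F = α * β ^ Fintype.card F := by
  have h0 := add_ne_zero_of_norm_ne hq h
  have h1 := pow_ne_zero (Fintype.card F) h0
  rw [zeta_mul hq hβ h, zeta_mul hq hα h.symm, add_comm β α, div_pow, mul_pow, hconj, hconj]
  field_simp

end Zeta

section Polynomial

variable {F : Type} [Field F]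

/-- The quaternion `1 + x·j + y·k` over `𝔽_q[t]`. -/
def polyOneAddJ (c x y : F) : ℍ[F[X], C c, X] := ⟨1, 0, C x, C y⟩

theorem polyOneAddJ_mul_eq {c : F} {E : Type} [Field E] [Algebra F E] {s : E}
    [Fintype F] (hq : Odd (Fintype.card F)) (hc : ¬IsSquare c)
    (hs : s ^ 2 = algebraMap F E c) {α β γ δ : E} {x₁ y₁ x₂ y₂ x₃ y₃ x₄ y₄ : F}
    (hα : hasCoord F E s α x₁ y₁) (hβ : hasCoord F E s β x₂ y₂)
    (hγ : hasCoord F E s γ x₃ y₃) (hδ : hasCoord F E s δ x₄ y₄)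
    (hadd : γ + δ = α + β)
    (hmul : γ * δ ^ Fintype.card F = α * β ^ Fintype.card F) :
    polyOneAddJ c x₃ y₃ * polyOneAddJ c x₄ y₄ = polyOneAddJ c x₁ y₁ * polyOneAddJ c x₂ y₂ := by
  unfold hasCoord at *
  subst hα hβ hγ hδ
  rw [conj_coord hq hc hs, conj_coord hq hc hs] at hmul
  obtain ⟨h1, h2⟩ := coord_unique (x := x₃ + x₄) (y := y₃ + y₄) (x' := x₁ + x₂) (y' := y₁ + y₂)
    hc hs (by simp only [map_add]; linear_combination hadd)
  obtain ⟨h3, h4⟩ := coord_unique (x := x₃ * x₄ - c * y₃ * y₄) (y := y₃ * x₄ - x₃ * y₄)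
    (x' := x₁ * x₂ - c * y₁ * y₂) (y' := y₁ * x₂ - x₁ * y₂) hc hs (by
      simp only [map_sub, map_mul, ← hs]; linear_combination hmul)
  replace h1 := congrArg (C (R := F)) h1
  replace h2 := congrArg (C (R := F)) h2
  replace h3 := congrArg (C (R := F)) h3
  replace h4 := congrArg (C (R := F)) h4
  simp only [map_add, map_sub, map_mul] at h1 h2 h3 h4
  simp only [polyOneAddJ, QuaternionAlgebra.mk_mul_mk]
  ext1
  · linear_combination (X : F[X]) * h3
  · linear_combination (X : F[X]) * h4
  · linear_combination h1
  · linear_combination h2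

/-- The splitting of the quaternion algebra over `E = F(s)`, specialised at `t = T`. -/
def splitAt {E : Type} [Field E] [Algebra F E] {c : F} {s : E} (hs : s ^ 2 = algebraMap F E c)
    (T : E) : ℍ[F[X], C c, X] →+* Matrix (Fin 2) (Fin 2) E where
  toFun z := !![aeval T z.re + aeval T z.imI * s, (aeval T z.imJ + aeval T z.imK * s) * T;
    aeval T z.imJ - aeval T z.imK * s, aeval T z.re - aeval T z.imI * s]
  map_one' := by ext i j; fin_cases i <;> fin_cases j <;> simp
  map_zero' := by ext i j; fin_cases i <;> fin_cases j <;> simp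
  map_add' z w := by ext i j; fin_cases i <;> fin_cases j <;> simp <;> ring
  map_mul' z w := by
    ext i j
    fin_cases i <;> fin_cases j <;> simp [Matrix.mul_apply, Fin.sum_univ_two, ← hs] <;> ring

theorem splitAt_polyOneAddJ {c : F} {E : Type} [Field E] [Algebra F E] {s : E}
    [Fintype F] (hq : Odd (Fintype.card F)) (hc : ¬IsSquare c)
    (hs : s ^ 2 = algebraMap F E c) (T : E) {α : E} {x y : F} (hα : hasCoord F E s α x y) :
    splitAt hs T (polyOneAddJ c x y) = !![1, α * T; α ^ Fintype.card F, 1] := by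
  unfold hasCoord at hα
  subst hα
  rw [conj_coord hq hc hs]
  simp [splitAt, polyOneAddJ]

end Polynomial

section Matrices

open Matrix

variable {E : Type} [Field E] {n : ℕ}

theorem row_vecMul {T α β : E} (hβ : β * β ^ n * T = 1) :
    ![1, α * T] ᵥ* !![1, β * T; β ^ n, 1] = (1 + α / β) • ![1, β * T] := by
  have h0 : β ≠ 0 := by rintro rfl; simp at hβ
  ext i
  fin_cases i
  · simp [vecMul, dotProduct]
    field_simp
    linear_combination α * hβ
  · simp [vecMul, dotProduct]
    field_simp

theorem row_vecMul_prod_ne_zero {T : E} (l : List E) (α : E)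
    (hl : ∀ β ∈ l, β * β ^ n * T = 1) (hchain : List.IsChain (fun α β => α ≠ -β) (α :: l)) :
    ![1, α * T] ᵥ* (l.map fun β => !![1, β * T; β ^ n, 1]).prod ≠ 0 := by
  induction l generalizing α with
  | nil =>
    intro h
    simpa using congrFun h 0
  | cons β l ih =>
    rw [List.isChain_cons_cons] at hchain
    have hβ := hl β (by simp)
    have h0 : β ≠ 0 := by rintro rfl; simp at hβ
    rw [List.map_cons, List.prod_cons, ← vecMul_vecMul, row_vecMul hβ, smul_vecMul]
    refine smul_ne_zero ?_ (ih β (fun γ hγ => hl γ (by simp [hγ])) hchain.2)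
    rw [one_add_div h0]
    refine div_ne_zero (fun h => hchain.1 ?_) h0
    linear_combination h

theorem prod_split_ne_smul_one {T : E} (α : E) (l₁ l₂ : List E) (hα : α * α ^ n * T = 1)
    (h₁ : ∀ β ∈ l₁, β * β ^ n * T = 1) (hchain : List.IsChain (fun α β => α ≠ -β) (α :: l₁))
    (h₂ : ∀ β ∈ l₂, β * β ^ n * T ≠ 1) (p : E) :
    ((α :: l₁ ++ l₂).map fun β => !![1, β * T; β ^ n, 1]).prod ≠ p • 1 := by
  intro h
  have hdet : ((l₂.map fun β => !![1, β * T; β ^ n, 1]).prod).det ≠ 0 := by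
    clear h
    induction l₂ with
    | nil => simp
    | cons β l ih =>
      rw [List.map_cons, List.prod_cons, det_mul]
      refine mul_ne_zero ?_ (ih fun γ hγ => h₂ γ (by simp [hγ]))
      rw [det_fin_two_of]
      intro h
      exact h₂ β (by simp) (by linear_combination -h)
  have hrow : ![1, 0] ᵥ* !![1, α * T; α ^ n, 1] = ![1, α * T] := by
    ext i; fin_cases i <;> simp [vecMul, dotProduct]
  have hker : ![1, -(α * T)] ᵥ* !![1, α * T; α ^ n, 1] = 0 := by
    ext i
    fin_cases i
    · simp [vecMul, dotProduct]
      linear_combination -hα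
    · simp [vecMul, dotProduct]
  rw [List.cons_append, List.map_cons, List.map_append, List.prod_cons, List.prod_append] at h
  have hp : p = 0 := by
    have := congrArg (fun M => ![1, -(α * T)] ᵥ* M) h
    simp only [← vecMul_vecMul, hker, zero_vecMul, vecMul_smul, vecMul_one] at this
    simpa using (congrFun this 0).symm
  have := congrArg (fun M => ![1, 0] ᵥ* M) h
  simp only [← vecMul_vecMul, hrow, hp, zero_smul, vecMul_zero] at this
  exact row_vecMul_prod_ne_zero l₁ α h₁ hchain (eq_zero_of_vecMul_eq_zero hdet this)

end Matrices

section Words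

variable {A G H N : Type*} [Group G] [Group H] {g : A → G} {ν : A → N}

theorem exists_swap_prod
    (hswap : ∀ a b, ν a ≠ ν b → ∃ c d, ν c = ν b ∧ ν d = ν a ∧ g a * g b = g c * g d)
    {n : N} (l : List A) (a : A) (hl : ∀ b ∈ l, ν b = n) (ha : ν a ≠ n) :
    ∃ (l' : List A) (a' : A), (∀ b ∈ l', ν b = n) ∧ ν a' ≠ n ∧ l'.length = l.length ∧
      g a * (l.map g).prod = (l'.map g).prod * g a' := by
  induction l generalizing a with
  | nil => exact ⟨[], a, by simp, ha, rfl, by simp⟩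
  | cons b l ih =>
    have hb : ν b = n := hl b (by simp)
    obtain ⟨c, d, hc, hd, h⟩ := hswap a b (by rwa [hb])
    obtain ⟨l', a', h1, h2, h3, h4⟩ := ih d (fun x hx => hl x (by simp [hx])) (by rwa [hd])
    refine ⟨c :: l', a', ?_, h2, by simp [h3], ?_⟩
    · simpa [hc, hb] using h1
    · rw [List.map_cons, List.prod_cons, ← mul_assoc, h, mul_assoc, h4, List.map_cons,
        List.prod_cons, mul_assoc]

theorem exists_sorted_prod
    (hswap : ∀ a b, ν a ≠ ν b → ∃ c d, ν c = ν b ∧ ν d = ν a ∧ g a * g b = g c * g d)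
    (n : N) (l : List A) :
    ∃ l₁ l₂ : List A, (∀ b ∈ l₁, ν b = n) ∧ (∀ b ∈ l₂, ν b ≠ n) ∧
      l₁.length + l₂.length = l.length ∧ (l.map g).prod = ((l₁ ++ l₂).map g).prod := by
  induction l with
  | nil => exact ⟨[], [], by simp, by simp, rfl, rfl⟩
  | cons a l ih =>
    obtain ⟨l₁, l₂, h1, h2, h3, h4⟩ := ih
    by_cases ha : ν a = n
    · refine ⟨a :: l₁, l₂, by simpa [ha] using h1, h2, ?_, ?_⟩
      · simp only [List.length_cons]
        omega
      · rw [List.map_cons, List.prod_cons, h4, List.cons_append, List.map_cons, List.prod_cons]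
    · obtain ⟨l', a', h5, h6, h7, h8⟩ := exists_swap_prod hswap l₁ a h1 ha
      refine ⟨l', a' :: l₂, h5, by simpa [h6] using h2, ?_, ?_⟩
      · simp only [List.length_cons]
        omega
      · rw [List.map_cons, List.prod_cons, h4, List.map_append, List.prod_append, ← mul_assoc, h8,
          List.map_append, List.prod_append, List.map_cons, List.prod_cons, mul_assoc]

theorem prod_eq_one_of_map_prod_eq_one
    (hswap : ∀ a b, ν a ≠ ν b → ∃ c d, ν c = ν b ∧ ν d = ν a ∧ g a * g b = g c * g d)
    {R : A → A → Prop} (hcancel : ∀ a b, ¬R a b → g a * g b = 1) (φ : G →* H)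
    (hred : ∀ (a : A) (l₁ l₂ : List A), (∀ b ∈ l₁, ν b = ν a) → (∀ b ∈ l₂, ν b ≠ ν a) →
      List.IsChain R (a :: l₁) → φ ((a :: l₁ ++ l₂).map g).prod ≠ 1)
    (l : List A) (h : φ (l.map g).prod = 1) : (l.map g).prod = 1 := by
  induction hn : l.length using Nat.strong_induction_on generalizing l with
  | _ n ih =>
    cases l with
    | nil => rfl
    | cons a l =>
      obtain ⟨l₁, l₂, h1, h2, h3, h4⟩ := exists_sorted_prod hswap (ν a) l
      have h5 : ((a :: l).map g).prod = ((a :: l₁ ++ l₂).map g).prod := by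
        rw [List.map_cons, List.prod_cons, h4, List.cons_append, List.map_cons, List.prod_cons]
      rw [h5] at h ⊢
      by_cases hchain : List.IsChain R (a :: l₁)
      · exact absurd h (hred a l₁ l₂ h1 h2 hchain)
      rw [List.isChain_iff_forall_rel_of_append_cons_cons] at hchain
      push Not at hchain
      obtain ⟨b, d, u, v, huv, hR⟩ := hchain
      have h6 : ((a :: l₁ ++ l₂).map g).prod = ((u ++ v ++ l₂).map g).prod := by
        rw [huv]
        simp only [List.map_append, List.map_cons, List.prod_append, List.prod_cons]
        rw [← mul_assoc (g b), hcancel b d hR, one_mul]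
      rw [h6] at h ⊢
      refine ih _ ?_ _ h rfl
      have := congrArg List.length huv
      simp only [List.length_cons, List.length_append] at this hn ⊢
      omega

theorem exists_list_prod_eq (hgen : Subgroup.closure (Set.range g) = ⊤)
    (hinv : ∀ a, ∃ b, g a * g b = 1) (x : G) : ∃ l : List A, x = (l.map g).prod := by
  have hx : x ∈ Subgroup.closure (Set.range g) := hgen ▸ Subgroup.mem_top x
  rw [← Subgroup.mem_toSubmonoid, Subgroup.closure_toSubmonoid] at hx
  obtain ⟨l, hl, rfl⟩ := Submonoid.exists_list_of_mem_closure hx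
  clear hx
  induction l with
  | nil => exact ⟨[], rfl⟩
  | cons y l ih =>
    obtain ⟨l', h'⟩ := ih fun z hz => hl z (by simp [hz])
    have hy : ∃ a, g a = y := by
      rcases hl y (by simp) with h | ⟨a, ha⟩
      · exact h
      · obtain ⟨b, hb⟩ := hinv a
        exact ⟨b, by rw [eq_inv_of_mul_eq_one_right hb, ha, inv_inv]⟩
    obtain ⟨a, rfl⟩ := hy
    exact ⟨a :: l', by rw [List.prod_cons, h', List.map_cons, List.prod_cons]⟩

end Words

section Localization

variable {F : Type} [Field F] {S₀ : Set F} {c : F}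

theorem algebraMap_OS_injective : Function.Injective (algebraMap F[X] (OS F S₀)) := by
  refine IsLocalization.injective (OS F S₀) (M := sden F S₀) ?_
  rw [sden, Submonoid.closure_le]
  rintro p (rfl | ⟨τ, -, rfl⟩)
  · exact mem_nonZeroDivisors_of_ne_zero X_ne_zero
  · exact mem_nonZeroDivisors_of_ne_zero (X_sub_C_ne_zero τ)

/-- The inclusion of the quaternions over `𝔽_q[t]` into the quaternions over `o_S`. -/
def polyToQAS (S₀ : Set F) (c : F) : ℍ[F[X], C c, X] →+* QAS F S₀ c :=
  quaternionMap (algebraMap F[X] (OS F S₀)) (C c) X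

theorem polyToQAS_polyOneAddJ (x y : F) :
    polyToQAS S₀ c (polyOneAddJ c x y) = oneAddJ F S₀ c x y := by
  simp [polyToQAS, quaternionMap, polyOneAddJ, oneAddJ, toOS]

theorem polyOneAddJ_mul_neg (x y : F) :
    polyOneAddJ c x y * polyOneAddJ c (-x) (-y) =
      algebraMap F[X] _ (1 - C (x ^ 2 - c * y ^ 2) * X) := by
  simp only [polyOneAddJ, QuaternionAlgebra.mk_mul_mk, QuaternionAlgebra.algebraMap_eq]
  ext1 <;> simp <;> ring

theorem polyToQAS_algebraMap (p : F[X]) :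
    polyToQAS S₀ c (algebraMap F[X] _ p) = algebraMap (OS F S₀) _ (algebraMap F[X] _ p) := by
  simp [polyToQAS, quaternionMap, QuaternionAlgebra.algebraMap_eq]

theorem oneAddJ_mul_neg (x y : F) :
    oneAddJ F S₀ c x y * oneAddJ F S₀ c (-x) (-y) =
      algebraMap (OS F S₀) _ (algebraMap F[X] _ (1 - C (x ^ 2 - c * y ^ 2) * X)) := by
  rw [← polyToQAS_polyOneAddJ, ← polyToQAS_polyOneAddJ, ← map_mul, polyOneAddJ_mul_neg,
    polyToQAS_algebraMap]

theorem isUnit_one_sub {τ : F} (hτ : τ ∈ S₀) (h0 : τ ≠ 0) :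
    IsUnit (algebraMap F[X] (OS F S₀) (1 - C τ⁻¹ * X)) := by
  have h : (1 - C τ⁻¹ * X : F[X]) = C (-τ⁻¹) * (X - C τ) := by
    have : C τ⁻¹ * C τ = (1 : F[X]) := by rw [← C_mul, inv_mul_cancel₀ h0, C_1]
    rw [C_neg]
    linear_combination -this
  rw [h, map_mul]
  refine IsUnit.mul (IsUnit.map _ (isUnit_C.2 (by simpa using h0))) ?_
  exact IsLocalization.map_units (OS F S₀)
    (⟨X - C τ, Submonoid.subset_closure (Or.inr ⟨τ, hτ, rfl⟩)⟩ : sden F S₀)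

theorem isUnit_oneAddJ {x y τ : F} (hτ : τ ∈ S₀) (h0 : τ ≠ 0) (h : x ^ 2 - c * y ^ 2 = τ⁻¹) :
    IsUnit (oneAddJ F S₀ c x y) := by
  have h1 := oneAddJ_mul_neg (S₀ := S₀) (c := c) x y
  have h2 := oneAddJ_mul_neg (S₀ := S₀) (c := c) (-x) (-y)
  rw [neg_neg, neg_neg, neg_sq, neg_sq, ← h1] at h2
  refine ((show Commute _ _ from h2.symm).isUnit_mul_iff.1 ?_).1
  rw [h1, h]
  exact (isUnit_one_sub hτ h0).map _

theorem eq_algebraMap_of_polyToQAS {P : ℍ[F[X], C c, X]} {r : OS F S₀}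
    (h : polyToQAS S₀ c P = algebraMap (OS F S₀) _ r) : P = algebraMap F[X] _ P.re := by
  have key : ∀ p : F[X], algebraMap F[X] (OS F S₀) p = 0 → p = 0 := fun p hp =>
    algebraMap_OS_injective (by rw [hp, map_zero])
  rw [QuaternionAlgebra.algebraMap_eq] at h ⊢
  ext1
  · rfl
  · exact key _ (congrArg QuaternionAlgebra.imI h)
  · exact key _ (congrArg QuaternionAlgebra.imJ h)
  · exact key _ (congrArg QuaternionAlgebra.imK h)

theorem splitAt_algebraMap {E : Type} [Field E] [Algebra F E] {s : E}
    (hs : s ^ 2 = algebraMap F E c) (T : E) (p : F[X]) :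
    splitAt hs T (algebraMap F[X] _ p) = aeval T p • (1 : Matrix (Fin 2) (Fin 2) E) := by
  ext i j
  fin_cases i <;> fin_cases j <;> simp [splitAt, QuaternionAlgebra.algebraMap_eq]

end Localization

section Classes

variable {F : Type} [Field F] [Fintype F] {S₀ : Set F} {c : F} {E : Type} [Field E] [Algebra F E]
  {s : E}

theorem norm_coord (hq : Odd (Fintype.card F)) (hc : ¬IsSquare c) (hs : s ^ 2 = algebraMap F E c)
    {α : E} {x y : F} (h : hasCoord F E s α x y) :
    α ^ (Fintype.card F + 1) = algebraMap F E (x ^ 2 - c * y ^ 2) := by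
  unfold hasCoord at h
  subst h
  rw [pow_succ, conj_coord hq hc hs]
  simp only [map_sub, map_mul, map_pow, ← hs]
  ring

theorem genSet_of_norm_eq (β : genSet F E S₀) {γ : E}
    (h : γ ^ (Fintype.card F + 1) = (β : E) ^ (Fintype.card F + 1)) : γ ∈ genSet F E S₀ := by
  obtain ⟨β, h0, τ, hτ, hβ⟩ := β
  refine ⟨?_, τ, hτ, h.trans hβ⟩
  rintro rfl
  rw [zero_pow (Nat.succ_ne_zero _)] at h
  exact pow_ne_zero _ h0 h.symm

theorem clsS_prod_ne_one (hq : Odd (Fintype.card F)) (hc : ¬IsSquare c)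
    (hs : s ^ 2 = algebraMap F E c) {x y : E → F} (hxy : ∀ α, hasCoord F E s α (x α) (y α))
    {w : genSet F E S₀ → (QAS F S₀ c)ˣ}
    (hw : ∀ α : genSet F E S₀, (w α : QAS F S₀ c) = oneAddJ F S₀ c (x α) (y α))
    (α : genSet F E S₀) (l₁ l₂ : List (genSet F E S₀))
    (h₁ : ∀ β ∈ l₁, (β : E) ^ (Fintype.card F + 1) = (α : E) ^ (Fintype.card F + 1))
    (h₂ : ∀ β ∈ l₂, (β : E) ^ (Fintype.card F + 1) ≠ (α : E) ^ (Fintype.card F + 1))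
    (hchain : List.IsChain (fun α β : genSet F E S₀ => (α : E) ≠ -β) (α :: l₁)) :
    clsS F S₀ c ((α :: l₁ ++ l₂).map w).prod ≠ 1 := by
  intro h
  obtain ⟨r, hr⟩ := (QuotientGroup.eq_one_iff _).1 h
  set P := ((α :: l₁ ++ l₂).map fun β : genSet F E S₀ => polyOneAddJ c (x β) (y β)).prod with hP
  have hPr : polyToQAS S₀ c P = algebraMap (OS F S₀) _ (r : OS F S₀) := by
    have := congrArg (Units.coeHom (QAS F S₀ c)) hr
    rw [map_list_prod, List.map_map] at this
    rw [hP, map_list_prod, List.map_map]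
    refine Eq.trans ?_ this.symm
    congr 2
    ext1 β
    simp [polyToQAS_polyOneAddJ, hw]
  have hα0 : (α : E) ^ (Fintype.card F + 1) ≠ 0 := pow_ne_zero _ α.2.1
  set T : E := ((α : E) ^ (Fintype.card F + 1))⁻¹ with hT
  have hTiff : ∀ β : E, β * β ^ Fintype.card F * T = 1 ↔
      β ^ (Fintype.card F + 1) = (α : E) ^ (Fintype.card F + 1) := by
    intro β
    rw [← pow_succ', hT, mul_inv_eq_one₀ hα0]
  have hsplit := congrArg (splitAt hs T) (eq_algebraMap_of_polyToQAS hPr)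
  rw [splitAt_algebraMap, hP, map_list_prod, List.map_map] at hsplit
  refine prod_split_ne_smul_one (n := Fintype.card F) (T := T) (α : E)
    (l₁.map Subtype.val) (l₂.map Subtype.val) ((hTiff _).2 rfl) ?_ ?_ ?_ _ (Eq.trans ?_ hsplit)
  · simp only [List.mem_map]
    rintro _ ⟨β, hβ, rfl⟩
    exact (hTiff _).2 (h₁ β hβ)
  · rw [← List.map_cons (f := Subtype.val), List.isChain_map]
    exact hchain
  · simp only [List.mem_map]
    rintro _ ⟨β, hβ, rfl⟩
    exact mt (hTiff _).1 (h₂ β hβ)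
  · rw [← List.map_cons (f := Subtype.val), ← List.map_append, List.map_map]
    congr 2
    ext1 β
    exact (splitAt_polyOneAddJ hq hc hs T (hxy β)).symm

end Classes

/-- `Γ_S` is isomorphic to the group presented by generators `a_α`,
`α ∈ A`, subject to `a_α a_{-α} = 1` and `a_α a_β = a_{ζ_α(β)β} a_{ζ_β(α)α}`, via
`a_α ↦ [1 + α·j]`. -/
theorem gammaS_presentation
    (F : Type) [Field F] [Fintype F] (hq : Odd (Fintype.card F))
    (c : F) (hc : ¬IsSquare c)
    (E : Type) [Field E] [Algebra F E] (s : E)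
    (hs : s ^ 2 = algebraMap F E c)
    (hspan : ∀ α : E, ∃ x y : F, hasCoord F E s α x y)
    (S₀ : Set F) (hS₀ : (0 : F) ∉ S₀) :
    ∃ iso : PresentedGroup (gammaRels F E S₀) ≃* GammaS F E s S₀ c,
      ∀ (α : genSet F E S₀) (x y : F) (w : (QAS F S₀ c)ˣ),
        hasCoord F E s (α : E) x y →
        (w : QAS F S₀ c) = oneAddJ F S₀ c x y →
        ((iso (PresentedGroup.of α) : GammaS F E s S₀ c) : LambdaS F S₀ c) =
          clsS F S₀ c w := by
  choose x y hxy using hspan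
  have hspan : ∀ α : E, ∃ x y : F, hasCoord F E s α x y := fun α => ⟨x α, y α, hxy α⟩
  have hconj := conj_conj hq hc hs hspan
  have hcoord : ∀ {α : E} {x' y' : F}, hasCoord F E s α x' y' → x' = x α ∧ y' = y α :=
    fun {α} _ _ h => coord_unique hc hs (h.symm.trans (hxy α))
  have hunit : ∀ α : genSet F E S₀, ∃ w : (QAS F S₀ c)ˣ,
      (w : QAS F S₀ c) = oneAddJ F S₀ c (x α) (y α) := by
    rintro ⟨α, -, τ, hτ, h⟩
    rw [norm_coord hq hc hs (hxy α)] at h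
    exact isUnit_oneAddJ hτ (fun h0 => hS₀ (h0 ▸ hτ)) ((algebraMap F E).injective h)
  choose w hw using hunit
  have hcancel : ∀ α α' : genSet F E S₀, (α' : E) = -(α : E) →
      clsS F S₀ c (w α) * clsS F S₀ c (w α') = 1 := by
    intro α α' h
    have hneg : hasCoord F E s (α' : E) (-x α) (-y α) := by
      have := hxy α
      unfold hasCoord at this ⊢
      rw [h, map_neg, map_neg]
      linear_combination -this
    obtain ⟨h1, h2⟩ := hcoord hneg
    obtain ⟨-, τ, hτ, hα⟩ := α.2
    rw [norm_coord hq hc hs (hxy α)] at hα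
    obtain ⟨u, hu⟩ := isUnit_one_sub hτ fun h0 => hS₀ (h0 ▸ hτ)
    rw [← map_mul]
    refine (QuotientGroup.eq_one_iff _).2 ⟨u, Units.ext ?_⟩
    rw [Units.val_mul, hw, hw, ← h1, ← h2, oneAddJ_mul_neg, (algebraMap F E).injective hα, ← hu]
    rfl
  have hrels : ∀ r ∈ gammaRels F E S₀, FreeGroup.lift (fun α => clsS F S₀ c (w α)) r = 1 := by
    rintro r (⟨α, α', h, rfl⟩ | ⟨α, β, γ, γ', hne, hγ, hγ', rfl⟩)
    · simpa using hcancel α α' h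
    · simp only [map_mul, map_inv, FreeGroup.lift_apply_of]
      rw [mul_inv_eq_one, ← map_mul, ← map_mul]
      congr 1
      ext1
      simp only [Units.val_mul, hw, ← polyToQAS_polyOneAddJ]
      rw [← map_mul, ← map_mul]
      congr 1
      refine (polyOneAddJ_mul_eq hq hc hs (hxy _) (hxy _) (hxy _) (hxy _) ?_ ?_).symm
      · rw [hγ, hγ', zeta_mul_add hq α.2.1 β.2.1 hne]
      · rw [hγ, hγ', zeta_mul_conj hq hconj α.2.1 β.2.1 hne]
  let φ : PresentedGroup (gammaRels F E S₀) →* LambdaS F S₀ c := PresentedGroup.toGroup hrels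
  have hφ : ∀ α, φ (PresentedGroup.of α) = clsS F S₀ c (w α) := fun α => PresentedGroup.toGroup.of _
  have hof_cancel : ∀ α α' : genSet F E S₀, (α' : E) = -(α : E) →
      (PresentedGroup.of α * PresentedGroup.of α' : PresentedGroup (gammaRels F E S₀)) = 1 :=
    fun α α' h => PresentedGroup.one_of_mem (Or.inl ⟨α, α', h, rfl⟩)
  have hinj : Function.Injective φ := by
    rw [injective_iff_map_eq_one]
    intro g hg
    obtain ⟨l, rfl⟩ := exists_list_prod_eq (PresentedGroup.closure_range_of _)
      (fun α : genSet F E S₀ => ⟨⟨-α, genSet_of_norm_eq α (hq.add_one.neg_pow _)⟩,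
        hof_cancel _ _ rfl⟩) g
    refine prod_eq_one_of_map_prod_eq_one
      (ν := fun α : genSet F E S₀ => (α : E) ^ (Fintype.card F + 1))
      (R := fun α β => (α : E) ≠ -β) ?_ ?_ φ ?_ l hg
    · intro α β hne
      have hγ := zeta_mul_norm hq hconj β.2.1 hne
      have hγ' := zeta_mul_norm hq hconj α.2.1 (Ne.symm hne)
      refine ⟨⟨_, genSet_of_norm_eq β hγ⟩, ⟨_, genSet_of_norm_eq α hγ'⟩, hγ, hγ', ?_⟩
      exact PresentedGroup.mk_eq_mk_of_mul_inv_mem (Or.inr ⟨α, β, _, _, hne, rfl, rfl, rfl⟩)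
    · intro α β h
      exact hof_cancel α β (by rw [not_not.1 h, neg_neg])
    · intro α l₁ l₂ h₁ h₂ hchain
      have := clsS_prod_ne_one hq hc hs hxy hw α l₁ l₂ h₁ h₂ hchain
      rw [map_list_prod, List.map_map] at this ⊢
      simpa only [Function.comp_def, hφ] using this
  have hrange : φ.range = GammaS F E s S₀ c := by
    rw [MonoidHom.range_eq_map, ← PresentedGroup.closure_range_of, MonoidHom.map_closure, GammaS]
    congr 1
    ext z
    simp only [Set.mem_image, Set.mem_range, exists_exists_eq_and, hφ, Set.mem_iUnion]
    constructor
    · rintro ⟨α, rfl⟩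
      obtain ⟨-, τ, hτ, h⟩ := α.2
      exact ⟨τ, hτ, α, _, _, w α, hxy α, h, hw α, rfl⟩
    · rintro ⟨τ, hτ, α, x', y', w', hα, h, hw', rfl⟩
      have hα0 : α ≠ 0 := by
        rintro rfl
        rw [zero_pow (Nat.succ_ne_zero _), eq_comm, map_eq_zero, inv_eq_zero] at h
        exact hS₀ (h ▸ hτ)
      refine ⟨⟨α, hα0, τ, hτ, h⟩, congrArg _ (Units.ext ?_)⟩
      rw [hw, hw', (hcoord hα).1, (hcoord hα).2]
  refine ⟨(φ.ofInjective hinj).trans (MulEquiv.subgroupCongr hrange), ?_⟩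
  intro α x' y' w' hα hw'
  refine (hφ α).trans (congrArg _ (Units.ext ?_))
  rw [hw, hw', (hcoord hα).1, (hcoord hα).2]
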